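/- arXiv:math/0611714 — 3 statements merged into one kernel-verified Lean document; each statement's English description precedes it below -/
import Mathlib

section
/- Let q be a quaternion with |q| > 1. The action of the group ℤ on ℍ \ {0} given by n • x = x·qⁿ is free (if x·qⁿ = x for some x ≠ 0 then n = 0) and properly discontinuous: for any two compact subsets A, B of ℍ \ {0}, the set of integers n with (n • A) ∩ B ≠ ∅ is finite. -/
open Quaternion

/-- A compact subset of a normed group that avoids `0` lies in a closed annulus of positive
inner radius. -/
theorem IsCompact.exists_pos_le_norm_le {E : Type*} [NormedAddCommGroup E] {A : Set E}
    (hA : IsCompact A) (h0 : (0 : E) ∉ A) :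
    ∃ r R : ℝ, 0 < r ∧ ∀ x ∈ A, r ≤ ‖x‖ ∧ ‖x‖ ≤ R := by
  obtain ⟨R, hR⟩ := hA.isBounded.exists_norm_le
  obtain ⟨r, hr, hball⟩ := Metric.isOpen_iff.mp hA.isClosed.isOpen_compl 0 h0
  refine ⟨r, R, hr, fun x hx => ⟨?_, hR x hx⟩⟩
  by_contra! hlt
  exact hball (mem_ball_zero_iff.mpr hlt) hx

/-- If `b = a * c ^ n` with `c > 1`, `a` bounded below by a positive number and `b` bounded
above, then the exponent `n` is bounded above. -/
theorem exists_exponent_lt_of_mul_zpow_eq {c r R : ℝ} (hc : 1 < c) (hr : 0 < r) :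
    ∃ N : ℤ, ∀ (n : ℤ) (a b : ℝ), r ≤ a → b ≤ R → a * c ^ n = b → n < N := by
  obtain ⟨N, hN⟩ := pow_unbounded_of_one_lt (R / r) hc
  refine ⟨N, fun n a b ha hb hab => (zpow_lt_zpow_iff_right₀ hc).mp ?_⟩
  rw [zpow_natCast]
  refine lt_of_le_of_lt ((le_div_iff₀' hr).mpr ?_) hN
  have hpos : 0 < c ^ n := zpow_pos (by linarith) n
  calc r * c ^ n ≤ a * c ^ n := by gcongr
    _ ≤ R := hab.trans_le hb

/-- For a quaternion `q` with `|q| > 1`, the ℤ-action `n • x = x·qⁿ` on `ℍ \ {0}`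
is free (if `x·qⁿ = x` for some `x ≠ 0` then `n = 0`) and properly discontinuous:
for any compact sets `A, B ⊆ ℍ \ {0}`, only finitely many `n` satisfy
`(n • A) ∩ B ≠ ∅`. -/
theorem hopf_action_free_properly_discontinuous
    (q : ℍ[ℝ]) (hq : 1 < ‖q‖) :
    (∀ x : ℍ[ℝ], x ≠ 0 → ∀ n : ℤ, x * q ^ n = x → n = 0) ∧
    (∀ A B : Set ℍ[ℝ], IsCompact A → IsCompact B → (0 : ℍ[ℝ]) ∉ A → (0 : ℍ[ℝ]) ∉ B →
      {n : ℤ | ((fun x : ℍ[ℝ] => x * q ^ n) '' A ∩ B).Nonempty}.Finite) := by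
  refine ⟨fun x hx n hn => ?_, fun A B hA hB hA0 hB0 => ?_⟩
  · have hpow : ‖q‖ ^ n = 1 := by
      rw [← norm_zpow, mul_eq_left₀ hx |>.mp hn, norm_one]
    exact (zpow_eq_one_iff_right₀ (norm_nonneg q) hq.ne').mp hpow
  · obtain ⟨r, R, hr, hrR⟩ := hA.exists_pos_le_norm_le hA0
    obtain ⟨s, S, hs, hsS⟩ := hB.exists_pos_le_norm_le hB0
    obtain ⟨N, hN⟩ := exists_exponent_lt_of_mul_zpow_eq (R := S) hq hr
    obtain ⟨M, hM⟩ := exists_exponent_lt_of_mul_zpow_eq (R := R) hq hs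
    refine (Set.finite_Ioo (-M) N).subset ?_
    rintro n ⟨_, ⟨x, hx, rfl⟩, hy⟩
    have hnorm : ‖x * q ^ n‖ = ‖x‖ * ‖q‖ ^ n := by rw [norm_mul, norm_zpow]
    have hpow : ‖q‖ ^ n ≠ 0 := (zpow_pos (by linarith) n).ne'
    have hupper := hN n _ _ (hrR x hx).1 (hsS _ hy).2 hnorm.symm
    have hlower := hM (-n) _ _ (hsS _ hy).1 (hrR x hx).2 (by
      rw [hnorm, zpow_neg, mul_inv_cancel_right₀ hpow])
    exact ⟨by linarith, hupper⟩
end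

section
/- Let q be a quaternion with |q| > 1. The quotient topological space X = (ℍ \ {0}) / ⟨q⟩, i.e., the space of orbits of the ℤ-action n • x = x·qⁿ on ℍ \ {0} with the quotient topology, is compact and Hausdorff. -/
open Quaternion

/-- The orbit equivalence relation of the ℤ-action `n • x = x·qⁿ` on `ℍ \ {0}`,
for a quaternion `q` with `|q| > 1`. -/
def hopfSetoid (q : ℍ[ℝ]) (hq : 1 < ‖q‖) : Setoid {x : ℍ[ℝ] // x ≠ 0} where
  r x y := ∃ n : ℤ, (y : ℍ[ℝ]) = (x : ℍ[ℝ]) * q ^ n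
  iseqv := by
    have hq0 : q ≠ 0 := by
      intro h
      rw [h, norm_zero] at hq
      linarith
    constructor
    · intro x
      exact ⟨0, by simp⟩
    · rintro x y ⟨n, hn⟩
      refine ⟨-n, ?_⟩
      rw [hn, mul_assoc, ← zpow_add₀ hq0]
      simp
    · rintro x y z ⟨n, hn⟩ ⟨m, hm⟩
      refine ⟨n + m, ?_⟩
      rw [hm, hn, mul_assoc, ← zpow_add₀ hq0]

theorem isOpenMap_hopf_mk (q : ℍ[ℝ]) (hq : 1 < ‖q‖) :
    IsOpenMap (Quotient.mk (hopfSetoid q hq)) := by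
  have hq0 : q ≠ 0 := norm_pos_iff.mp (one_pos.trans hq)
  intro U hU
  rw [← isQuotientMap_quotient_mk'.isOpen_preimage]
  have key : Quotient.mk (hopfSetoid q hq) ⁻¹' (Quotient.mk (hopfSetoid q hq) '' U) =
      ⋃ n : ℤ, (fun x : {x : ℍ[ℝ] // x ≠ 0} ↦
        (⟨x * q ^ n, mul_ne_zero x.2 (zpow_ne_zero n hq0)⟩ : {x : ℍ[ℝ] // x ≠ 0})) ⁻¹' U := by
    ext x
    simp only [Set.mem_preimage, Set.mem_image, Set.mem_iUnion]
    constructor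
    · rintro ⟨y, hy, hyx⟩
      obtain ⟨n, hn⟩ := (hopfSetoid q hq).symm (Quotient.exact hyx)
      exact ⟨n, by convert hy; exact hn.symm⟩
    · rintro ⟨n, hn⟩
      exact ⟨_, hn, Quotient.sound ((hopfSetoid q hq).symm ⟨n, rfl⟩)⟩
  refine key ▸ isOpen_iUnion fun n ↦ hU.preimage ?_
  fun_prop

theorem locallyFinite_singleton_intCast : LocallyFinite fun n : ℤ ↦ ({(n : ℝ)} : Set ℝ) := by
  intro x
  refine ⟨Metric.ball x 1, Metric.ball_mem_nhds x one_pos,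
    (Set.finite_Icc ⌊x - 1⌋ ⌈x + 1⌉).subset ?_⟩
  rintro n ⟨y, rfl, hy⟩
  rw [Metric.mem_ball, Real.dist_eq, abs_lt] at hy
  constructor
  · exact_mod_cast (Int.floor_le (x - 1)).trans (by linarith : x - 1 ≤ n)
  · exact_mod_cast (by linarith : (n : ℝ) ≤ x + 1).trans (Int.le_ceil (x + 1))

theorem isClosed_hopf_rel (q : ℍ[ℝ]) (hq : 1 < ‖q‖) :
    IsClosed {p : {x : ℍ[ℝ] // x ≠ 0} × {x : ℍ[ℝ] // x ≠ 0} |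
      ∃ n : ℤ, (p.2 : ℍ[ℝ]) = p.1 * q ^ n} := by
  rw [Set.ofPred_exists]
  have hcont : Continuous fun p : {x : ℍ[ℝ] // x ≠ 0} × {x : ℍ[ℝ] // x ≠ 0} ↦
      (Real.log ‖(p.2 : ℍ[ℝ])‖ - Real.log ‖(p.1 : ℍ[ℝ])‖) / Real.log ‖q‖ := by
    refine ((Continuous.log (by fun_prop) fun p ↦ norm_ne_zero_iff.mpr p.2.2).sub
      (Continuous.log (by fun_prop) fun p ↦ norm_ne_zero_iff.mpr p.1.2)).div_const _
  refine ((locallyFinite_singleton_intCast.preimage_continuous hcont).subset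
    fun n p hp ↦ ?_).isClosed_iUnion fun n ↦ isClosed_eq (by fun_prop) (by fun_prop)
  have hq0 : ‖q‖ ≠ 0 := (one_pos.trans hq).ne'
  have hlog : Real.log ‖q‖ ≠ 0 := (Real.log_pos hq).ne'
  have hp' : (p.2 : ℍ[ℝ]) = p.1 * q ^ n := hp
  rw [Set.mem_preimage, Set.mem_singleton_iff, hp', norm_mul, norm_zpow,
    Real.log_mul (norm_ne_zero_iff.mpr p.1.2) (zpow_ne_zero n hq0), Real.log_zpow]
  field_simp
  ring

theorem isCompact_annulus (r : ℝ) :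
    IsCompact {x : {x : ℍ[ℝ] // x ≠ 0} | 1 ≤ ‖(x : ℍ[ℝ])‖ ∧ ‖(x : ℍ[ℝ])‖ ≤ r} := by
  have := FiniteDimensional.proper ℝ ℍ[ℝ]
  rw [Subtype.isCompact_iff]
  have key : Subtype.val '' {x : {x : ℍ[ℝ] // x ≠ 0} | 1 ≤ ‖(x : ℍ[ℝ])‖ ∧ ‖(x : ℍ[ℝ])‖ ≤ r} =
      Metric.closedBall 0 r ∩ {x : ℍ[ℝ] | 1 ≤ ‖x‖} := by
    ext x
    simp only [Set.mem_image, Set.mem_ofPred_eq, Set.mem_inter_iff, mem_closedBall_zero_iff]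
    constructor
    · rintro ⟨y, hy, rfl⟩
      exact hy.symm
    · rintro ⟨hr, h1⟩
      exact ⟨⟨x, norm_pos_iff.mp (one_pos.trans_le h1)⟩, ⟨h1, hr⟩, rfl⟩
  rw [key]
  exact (isCompact_closedBall 0 r).inter_right (isClosed_le continuous_const continuous_norm)

theorem image_annulus_eq_univ (q : ℍ[ℝ]) (hq : 1 < ‖q‖) :
    Quotient.mk (hopfSetoid q hq) ''
      {x : {x : ℍ[ℝ] // x ≠ 0} | 1 ≤ ‖(x : ℍ[ℝ])‖ ∧ ‖(x : ℍ[ℝ])‖ ≤ ‖q‖} = Set.univ := by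
  have hq0 : q ≠ 0 := norm_pos_iff.mp (one_pos.trans hq)
  refine Set.eq_univ_of_forall fun z ↦ ?_
  obtain ⟨x, rfl⟩ := Quotient.exists_rep z
  obtain ⟨n, hn, hn'⟩ := exists_mem_Ico_zpow (norm_pos_iff.mpr x.2) hq
  have hpos : 0 < ‖q‖ ^ n := zpow_pos (one_pos.trans hq) n
  refine ⟨⟨x * q ^ (-n), mul_ne_zero x.2 (zpow_ne_zero _ hq0)⟩, ?_,
    Quotient.sound ((hopfSetoid q hq).symm ⟨-n, rfl⟩)⟩
  rw [zpow_add_one₀ (norm_ne_zero_iff.mpr hq0)] at hn'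
  rw [Set.mem_ofPred_eq, norm_mul, norm_zpow, zpow_neg, ← div_eq_mul_inv, one_le_div hpos, div_le_iff₀ hpos, mul_comm]
  exact ⟨hn, hn'.le⟩

/-- The quaternionic Hopf surface `X = (ℍ \ {0}) / ⟨q⟩`, i.e. the quotient of the
nonzero quaternions by the ℤ-action `n • x = x·qⁿ` (with `|q| > 1`), equipped with
the quotient topology, is compact and Hausdorff. -/
theorem hopf_surface_compact_hausdorff (q : ℍ[ℝ]) (hq : 1 < ‖q‖) :
    CompactSpace (Quotient (hopfSetoid q hq)) ∧ T2Space (Quotient (hopfSetoid q hq)) := by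
  constructor
  · rw [← isCompact_univ_iff, ← image_annulus_eq_univ q hq]
    exact (isCompact_annulus ‖q‖).image continuous_quotient_mk'
  · have hopen : IsOpenQuotientMap (Quotient.mk (hopfSetoid q hq)) :=
      ⟨Quotient.mk_surjective, continuous_quotient_mk', isOpenMap_hopf_mk q hq⟩
    rw [t2Space_iff_of_isOpenQuotientMap hopen]
    convert isClosed_hopf_rel q hq using 1
    ext p
    exact Quotient.eq (r := hopfSetoid q hq)
end

section
/- Let α : ℍ × ℍ → ℝ be an alternating bilinear form on the quaternions, and let I = L_i, J = L_j, K = L_k be the left hypercomplex structure on ℍ. Then α satisfies α(Ix, Iy) = α(x, y), α(Jx, Jy) = α(x, y), and α(Kx, Ky) = α(x, y) for all x, y ∈ ℍ if and only if α(1, i) + α(j, k) = 0, α(1, j) + α(k, i) = 0, and α(1, k) + α(i, j) = 0. (These three equations express that α is anti-self-dual with respect to the Euclidean metric; thus a 2-form on ℍ is of type (1,1) with respect to all three complex structures exactly when it is anti-self-dual — the pointwise content of the equivalence between hyperholomorphic and anti-self-dual connections.) -/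
open Quaternion

/-- An alternating bilinear form on ℍ, expanded in the basis `1, i, j, k`. -/
theorem alternating_apply_eq_sum_minors
    (α : ℍ[ℝ] →ₗ[ℝ] ℍ[ℝ] →ₗ[ℝ] ℝ) (halt : ∀ x, α x x = 0) (x y : ℍ[ℝ]) :
    α x y =
      (x.re * y.imI - x.imI * y.re) * α 1 ⟨0, 1, 0, 0⟩
      + (x.re * y.imJ - x.imJ * y.re) * α 1 ⟨0, 0, 1, 0⟩
      + (x.re * y.imK - x.imK * y.re) * α 1 ⟨0, 0, 0, 1⟩
      + (x.imJ * y.imK - x.imK * y.imJ) * α ⟨0, 0, 1, 0⟩ ⟨0, 0, 0, 1⟩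
      + (x.imK * y.imI - x.imI * y.imK) * α ⟨0, 0, 0, 1⟩ ⟨0, 1, 0, 0⟩
      + (x.imI * y.imJ - x.imJ * y.imI) * α ⟨0, 1, 0, 0⟩ ⟨0, 0, 1, 0⟩ := by
  set i : ℍ[ℝ] := ⟨0, 1, 0, 0⟩ with hi
  set j : ℍ[ℝ] := ⟨0, 0, 1, 0⟩ with hj
  set k : ℍ[ℝ] := ⟨0, 0, 0, 1⟩ with hk
  have decomp (z : ℍ[ℝ]) :
      z = z.re • (1 : ℍ[ℝ]) + z.imI • i + z.imJ • j + z.imK • k := by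
    ext <;> simp <;> simp [hi, hj, hk]
  have skew (u v : ℍ[ℝ]) : α u v = -α v u := (LinearMap.IsAlt.neg halt v u).symm
  conv_lhs => rw [decomp x, decomp y]
  simp only [map_add, map_smul, LinearMap.add_apply, LinearMap.smul_apply, smul_eq_mul, halt]
  rw [skew i 1, skew j 1, skew k 1, skew k j, skew i k, skew j i]
  ring

/-- An alternating bilinear form `α` on ℍ is invariant under the left hypercomplex
structure `I = L_i`, `J = L_j`, `K = L_k` (i.e. of type (1,1) for all three
complex structures) if and only if `α(1,i) + α(j,k) = 0`, `α(1,j) + α(k,i) = 0`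
and `α(1,k) + α(i,j) = 0`, i.e. exactly when `α` is anti-self-dual. -/
theorem type_one_one_iff_anti_self_dual
    (α : ℍ[ℝ] →ₗ[ℝ] ℍ[ℝ] →ₗ[ℝ] ℝ)
    (halt : ∀ x, α x x = 0) :
    let i : ℍ[ℝ] := ⟨0, 1, 0, 0⟩
    let j : ℍ[ℝ] := ⟨0, 0, 1, 0⟩
    let k : ℍ[ℝ] := ⟨0, 0, 0, 1⟩
    ((∀ x y, α (i * x) (i * y) = α x y) ∧
     (∀ x y, α (j * x) (j * y) = α x y) ∧
     (∀ x y, α (k * x) (k * y) = α x y)) ↔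
    (α 1 i + α j k = 0 ∧ α 1 j + α k i = 0 ∧ α 1 k + α i j = 0) := by
  intro i j k
  have expand := alternating_apply_eq_sum_minors α halt
  constructor
  · rintro ⟨hI, hJ, -⟩
    have hji : j * i = -k := by ext <;> simp <;> simp [i, j, k]
    have hik : i * k = -j := by ext <;> simp <;> simp [i, j, k]
    have hij : i * j = k := by ext <;> simp <;> simp [i, j, k]
    have h₁ := hJ 1 i
    have h₂ := hI 1 j
    have h₃ := hI 1 k
    rw [mul_one, hji, map_neg] at h₁
    rw [mul_one, hij, ← (LinearMap.IsAlt.neg halt k i)] at h₂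
    rw [mul_one, hik, map_neg] at h₃
    exact ⟨by linarith, by linarith, by linarith⟩
  · rintro ⟨h₁, h₂, h₃⟩
    refine ⟨fun x y => ?_, fun x y => ?_, fun x y => ?_⟩
    · rw [expand (i * x), expand x]
      simp only [Quaternion.re_mul, Quaternion.imI_mul, Quaternion.imJ_mul, Quaternion.imK_mul]
      simp only [i, j, k] at h₁ h₂ h₃ ⊢
      linear_combination
        (-(x.re * y.imJ - x.imJ * y.re) - (x.imK * y.imI - x.imI * y.imK)) * h₂
        + (-(x.re * y.imK - x.imK * y.re) - (x.imI * y.imJ - x.imJ * y.imI)) * h₃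
    · rw [expand (j * x), expand x]
      simp only [Quaternion.re_mul, Quaternion.imI_mul, Quaternion.imJ_mul, Quaternion.imK_mul]
      simp only [i, j, k] at h₁ h₂ h₃ ⊢
      linear_combination
        (-(x.re * y.imI - x.imI * y.re) - (x.imJ * y.imK - x.imK * y.imJ)) * h₁
        + (-(x.re * y.imK - x.imK * y.re) - (x.imI * y.imJ - x.imJ * y.imI)) * h₃
    · rw [expand (k * x), expand x]
      simp only [Quaternion.re_mul, Quaternion.imI_mul, Quaternion.imJ_mul, Quaternion.imK_mul]
      simp only [i, j, k] at h₁ h₂ h₃ ⊢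
      linear_combination
        (-(x.re * y.imI - x.imI * y.re) - (x.imJ * y.imK - x.imK * y.imJ)) * h₁
        + (-(x.re * y.imJ - x.imJ * y.re) - (x.imK * y.imI - x.imI * y.imK)) * h₂
end
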